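/- If (M, a, s) is a solution with M > 1 and M is itself a perfect square, then there exists an integer n such that M = (6n − 1)²; consequently M ≡ 1 (mod 24) and (M − 1)/24 = n(3n − 1)/2 is a generalized pentagonal number. -/

import Mathlib

theorem six_mul_sum_range_add_sq (a M : ℕ) :
    6 * ∑ i ∈ Finset.range M, ((a : ℤ) + i) ^ 2 =
      M * (6 * a ^ 2 + 6 * a * (M - 1) + (M - 1) * (2 * M - 1)) := by
  induction M with
  | zero => simp
  | succ k ih =>
    rw [Finset.sum_range_succ, mul_add, ih]
    push_cast
    ring

theorem Nat.dvd_of_sq_dvd_six_mul_sq {m s : ℕ} (hm : 0 < m) (h : m ^ 2 ∣ 6 * s ^ 2) : m ∣ s := by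
  obtain ⟨m', s', hco, hm', hs'⟩ := Nat.exists_coprime m s
  have hg : 0 < m.gcd s := Nat.gcd_pos_of_pos_left s hm
  have h' : m' ^ 2 ∣ 6 * s' ^ 2 := by
    generalize m.gcd s = g at hm' hs' hg
    subst hm' hs'
    rw [mul_pow, mul_pow, ← mul_assoc] at h
    exact Nat.dvd_of_mul_dvd_mul_right (pow_pos hg 2) h
  have h6 : m' ^ 2 ∣ 6 := (hco.pow 2 2).dvd_of_dvd_mul_right h'
  have hle : m' ≤ 2 := by
    have := Nat.le_of_dvd (by norm_num) h6
    nlinarith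
  have hm1 : m' = 1 := by interval_cases m' <;> revert h6 <;> decide
  rw [hm1, one_mul] at hm'
  exact hm' ▸ Nat.gcd_dvd_right m s

theorem Int.exists_sq_eq_six_mul_sub_one_sq {m : ℤ} (h : m % 6 = 1 ∨ m % 6 = 5) :
    ∃ n : ℤ, m ^ 2 = (6 * n - 1) ^ 2 := by
  rcases h with h | h
  · refine ⟨-(m / 6), ?_⟩
    have : m = 6 * (m / 6) + 1 := by omega
    linear_combination (m + 6 * (m / 6) + 1) * this
  · refine ⟨m / 6 + 1, ?_⟩
    have : m = 6 * (m / 6) + 5 := by omega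
    linear_combination (m + 6 * (m / 6) + 5) * this

theorem solution_M_square (M a s : ℕ) (hM : 1 < M) (ha : 1 ≤ a) (hs : 1 ≤ s)
    (hsol : ∑ i ∈ Finset.range M, (a + i) ^ 2 = s ^ 2)
    (hsq : IsSquare M) :
    ∃ n : ℤ, (M : ℤ) = (6 * n - 1) ^ 2 ∧ M % 24 = 1 ∧
      ((M : ℤ) - 1) / 24 = n * (3 * n - 1) / 2 := by
  obtain ⟨m, rfl⟩ := hsq
  have hm : 0 < m := by
    rcases Nat.eq_zero_or_pos m with rfl | h
    · simp at hM
    · exact h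
  have hsum := six_mul_sum_range_add_sq a (m * m)
  have hsolZ : ∑ i ∈ Finset.range (m * m), ((a : ℤ) + i) ^ 2 = (s : ℤ) ^ 2 := by
    exact_mod_cast hsol
  rw [hsolZ] at hsum
  have hdvd : m ^ 2 ∣ 6 * s ^ 2 := by
    rw [← Int.natCast_dvd_natCast]
    push_cast at hsum ⊢
    rw [hsum, sq (m : ℤ)]
    exact dvd_mul_right _ _
  obtain ⟨t, rfl⟩ := Nat.dvd_of_sq_dvd_six_mul_sq hm hdvd
  have hmZ : (m : ℤ) ^ 2 ≠ 0 := by positivity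
  push_cast at hsum
  have hX : 6 * (t : ℤ) ^ 2 =
      6 * a ^ 2 + 6 * a * (m * m - 1) + (m * m - 1) * (2 * (m * m) - 1) := by
    apply mul_left_cancel₀ hmZ
    linear_combination hsum
  have h6 : ((m : ℤ) * m - 1) * (2 * (m * m) - 1) % 6 = 0 :=
    Int.emod_eq_zero_of_dvd ⟨t ^ 2 - a ^ 2 - a * (m * m - 1), by linear_combination -hX⟩
  have hmod : (m : ℤ) % 6 = 1 ∨ (m : ℤ) % 6 = 5 := by
    have hcases : (m : ℤ) % 6 = 0 ∨ (m : ℤ) % 6 = 1 ∨ (m : ℤ) % 6 = 2 ∨ (m : ℤ) % 6 = 3 ∨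
        (m : ℤ) % 6 = 4 ∨ (m : ℤ) % 6 = 5 := by omega
    rcases hcases with h | h | h | h | h | h <;>
      simp [Int.mul_emod, Int.sub_emod, h] at h6 ⊢
  obtain ⟨n, hn⟩ := Int.exists_sq_eq_six_mul_sub_one_sq hmod
  have heven : ∃ k, n * (3 * n - 1) = 2 * k := by
    rcases Int.even_or_odd' n with ⟨j, rfl | rfl⟩
    · exact ⟨j * (6 * j - 1), by ring⟩
    · exact ⟨(2 * j + 1) * (3 * j + 1), by ring⟩
  obtain ⟨k, hk⟩ := heven
  have hMk : ((m * m : ℕ) : ℤ) = 24 * k + 1 := by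
    push_cast
    linear_combination hn + 12 * hk
  refine ⟨n, ?_, ?_, ?_⟩
  · push_cast
    linear_combination hn
  · omega
  · rw [hk]
    omega
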